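/- Let f(x) ∈ ℤ[x] be an irreducible polynomial of degree d, let b be a fixed non-zero integer and A_1,...,A_r fixed positive integers, and assume d > r. Then the equation f(x) = b·(n_1!·A_1^{n_1})···(n_r!·A_r^{n_r}) has only finitely many solutions in positive integers n_1,...,n_r and integers x. -/

import Mathlib

section Helpers
open NumberField Polynomial Filter Topology

lemma aux_count (K : Type*) [Field K] [NumberField K] :
    ∃ ρ : ℝ, 0 < ρ ∧ Tendsto (fun n : ℕ ↦
      ((Ideal.finite_setOfPred_absNorm_le (S := 𝓞 K) n).toFinset.card : ℝ) / n) atTop (𝓝 ρ) := by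
  refine ⟨dedekindZeta_residue K, dedekindZeta_residue_pos K, ?_⟩
  refine ((NumberField.Ideal.tendsto_norm_le_div_atTop K).comp tendsto_natCast_atTop_atTop).congr
    fun n => ?_
  simp only [Function.comp_apply, Nat.cast_le]
  congr 2
  exact Set.ncard_eq_toFinset_card _ (Ideal.finite_setOfPred_absNorm_le (S := 𝓞 K) n)

lemma aux_ideal_of_nat {K : Type*} [Field K] [NumberField K] (P : ℕ → Ideal (𝓞 K)) (m : ℕ)
    (hm : m ≠ 0) (hP : ∀ p : ℕ, p.Prime → p ∣ m → Ideal.absNorm (P p) = p) :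
    Ideal.absNorm (m.primeFactorsList.map P).prod = m := by
  rw [map_list_prod, List.map_map]
  conv_rhs => rw [← Nat.prod_primeFactorsList hm]
  congr 1
  conv_rhs => rw [← List.map_id m.primeFactorsList]
  apply List.map_congr_left
  intro p hp
  exact hP p (Nat.prime_of_mem_primeFactorsList hp) (Nat.dvd_of_mem_primeFactorsList hp)

lemma aux_prime_ideal {K : Type*} [Field K] [NumberField K] (P : Ideal (𝓞 K)) {p : ℕ}
    (hp : p.Prime) (h : Ideal.absNorm P = p) : Prime P := by
  have : Irreducible P := Ideal.irreducible_of_irreducible_absNorm (by rw [h]; exact hp)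
  exact this.prime

lemma aux_eq_of_dvd {K : Type*} [Field K] [NumberField K] {P Q : Ideal (𝓞 K)} {p q : ℕ}
    (hp : p.Prime) (hq : q.Prime) (h : Ideal.absNorm P = p) (h' : Ideal.absNorm Q = q)
    (hd : P ∣ Q) : P = Q :=
  associated_iff_eq.1 ((aux_prime_ideal P hp h).irreducible.associated_of_dvd
    (aux_prime_ideal Q hq h').irreducible hd)

lemma aux_two_bound {K : Type*} [Field K] [NumberField K] (B : ℕ)
    (hP : ∀ p : ℕ, p.Prime → B < p → ∃ P : Ideal (𝓞 K), Ideal.absNorm P = p) :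
    ∃ C : ℝ, ∀ S : Finset ℕ, (∀ q ∈ S, q.Prime ∧ B < q ∧
      ∃ P Q : Ideal (𝓞 K), P ≠ Q ∧ Ideal.absNorm P = q ∧ Ideal.absNorm Q = q) →
      ∑ q ∈ S, (q : ℝ)⁻¹ ≤ C := by
  obtain ⟨ρ, hρ, hlim⟩ := aux_count K
  choose! P hPn using hP
  set M := B.factorial with hM
  have hMpos : 0 < M := Nat.factorial_pos B
  refine ⟨ρ * M, fun S hS => ?_⟩
  have hQ : ∀ q ∈ S, ∃ Q : Ideal (𝓞 K), Q ≠ P q ∧ Ideal.absNorm Q = q := by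
    intro q hq
    obtain ⟨_, _, P1, P2, hne, h1, h2⟩ := hS q hq
    by_cases h : P1 = P q
    · exact ⟨P2, fun h' => hne (h.trans h'.symm), h2⟩
    · exact ⟨P1, h, h1⟩
  choose! Q hQne hQn using hQ
  have hgood : ∀ k p : ℕ, p.Prime → p ∣ 1 + k * M → B < p := by
    intro k p hp hd
    by_contra! hle
    have h1 : p ∣ k * M := (hp.dvd_factorial.2 hle).mul_left k
    exact hp.one_lt.ne' (Nat.dvd_one.1 ((Nat.dvd_add_left h1).1 hd))
  set I : ℕ → Ideal (𝓞 K) := fun m => (m.primeFactorsList.map P).prod with hI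
  have hIn : ∀ k, Ideal.absNorm (I (1 + k * M)) = 1 + k * M := fun k =>
    aux_ideal_of_nat P _ (by omega) fun p hp hd => hPn p hp (hgood k p hp hd)
  set J : (Σ _ : ℕ, ℕ) → Ideal (𝓞 K) := fun x => I (1 + x.2 * M) * Q x.1 with hJ
  have hJn : ∀ x : (Σ _ : ℕ, ℕ), x.1 ∈ S → Ideal.absNorm (J x) = (1 + x.2 * M) * x.1 := by
    intro x hx
    simp only [hJ, map_mul, hIn, hQn _ hx]
  have hinj : ∀ x y : (Σ _ : ℕ, ℕ), x.1 ∈ S → y.1 ∈ S → J x = J y → x = y := by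
    rintro ⟨q, k⟩ ⟨q', k'⟩ hx hy hxy
    have hnorm := congrArg Ideal.absNorm hxy
    rw [hJn _ hx, hJn _ hy] at hnorm
    simp only at hx hy hnorm
    have hqp := (hS q hx).1
    have hqp' := (hS q' hy).1
    have hqq : q = q' := by
      have hd : Q q ∣ I (1 + k' * M) * Q q' := by
        have : J ⟨q, k⟩ = I (1 + k' * M) * Q q' := hxy
        rw [← this]
        exact Dvd.intro_left _ rfl
      have hpr := aux_prime_ideal (Q q) hqp (hQn q hx)
      rcases hpr.dvd_or_dvd hd with h | h
      · exfalso
        obtain ⟨R, hR, hdR⟩ := (Prime.dvd_prod_iff hpr).1 h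
        obtain ⟨p, hp, rfl⟩ := List.mem_map.1 hR
        have hpp := Nat.prime_of_mem_primeFactorsList hp
        have hpn := hPn p hpp (hgood k' p hpp (Nat.dvd_of_mem_primeFactorsList hp))
        have heq := aux_eq_of_dvd hqp hpp (hQn q hx) hpn hdR
        have : q = p := by rw [← hQn q hx, heq, hpn]
        subst this
        exact hQne q hx heq
      · have heq := aux_eq_of_dvd hqp hqp' (hQn q hx) (hQn q' hy) h
        rw [← hQn q hx, heq, hQn q' hy]
    subst hqq
    have h1 := Nat.eq_of_mul_eq_mul_right hqp.pos hnorm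
    have h2 : k = k' := Nat.eq_of_mul_eq_mul_right hMpos (by omega)
    rw [h2]
  have hcard : ∀ n : ℕ, ∑ q ∈ S, n / (q * M) ≤
      (Ideal.finite_setOfPred_absNorm_le (S := 𝓞 K) n).toFinset.card := by
    intro n
    have e : (S.sigma fun q => Finset.range (n / (q * M))).card = ∑ q ∈ S, n / (q * M) := by
      simp [Finset.card_sigma]
    rw [← e]
    apply Finset.card_le_card_of_injOn J
    · rintro ⟨q, k⟩ hx
      simp only [Finset.coe_sigma, Set.mem_sigma_iff, Finset.mem_coe, Finset.mem_range] at hx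
      simp only [Set.Finite.coe_toFinset, Set.mem_ofPred_eq]
      rw [hJn _ hx.1]
      have h1 : (k + 1) * (q * M) ≤ n :=
        (Nat.mul_le_mul_right _ hx.2).trans (Nat.div_mul_le_self _ _)
      calc (1 + k * M) * q ≤ (k + 1) * (q * M) := by nlinarith [Nat.zero_le q, Nat.mul_le_mul_left q hMpos]
        _ ≤ n := h1
    · intro x hx y hy hxy
      simp only [Finset.coe_sigma, Set.mem_sigma_iff, Finset.mem_coe, Finset.mem_range] at hx hy
      exact hinj x y hx.1 hy.1 hxy
  have hle : ∑ q ∈ S, (q : ℝ)⁻¹ * (M : ℝ)⁻¹ ≤ ρ := by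
    have hl : Tendsto (fun n : ℕ => ∑ q ∈ S, ((q : ℝ)⁻¹ * (M : ℝ)⁻¹ - (n : ℝ)⁻¹)) atTop
        (𝓝 (∑ q ∈ S, ((q : ℝ)⁻¹ * (M : ℝ)⁻¹ - 0))) :=
      tendsto_finsetSum _ fun q _ => tendsto_const_nhds.sub tendsto_inv_atTop_nhds_zero_nat
    simp only [sub_zero] at hl
    refine le_of_tendsto_of_tendsto hl hlim ?_
    filter_upwards [eventually_gt_atTop 0] with n hn
    have hn' : (0 : ℝ) < n := by exact_mod_cast hn
    rw [le_div_iff₀ hn', Finset.sum_mul]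
    have := hcard n
    have h2 : ((∑ q ∈ S, n / (q * M) : ℕ) : ℝ) ≤
      (Ideal.finite_setOfPred_absNorm_le (S := 𝓞 K) n).toFinset.card := by exact_mod_cast this
    refine le_trans ?_ h2
    push_cast
    apply Finset.sum_le_sum
    intro q hq
    have h3 := (Nat.lt_floor_add_one ((n : ℝ) / (q * M : ℕ)))
    rw [Nat.floor_div_natCast, Nat.floor_natCast] at h3
    have : ((q : ℝ)⁻¹ * (M : ℝ)⁻¹ - (n : ℝ)⁻¹) * n = (n : ℝ) / (q * M : ℕ) - 1 := by
      have : (q : ℝ) ≠ 0 := by exact_mod_cast (hS q hq).1.ne_zero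
      have : (M : ℝ) ≠ 0 := by exact_mod_cast hMpos.ne'
      push_cast
      field_simp
    linarith
  rw [← Finset.sum_mul, ← div_eq_mul_inv, div_le_iff₀ (by exact_mod_cast hMpos)] at hle
  exact hle

open IsDedekindDomain in
lemma aux_euler (K : Type*) [Field K] [NumberField K] (C : ℝ)
    (hC : ∀ T : Finset (HeightOneSpectrum (𝓞 K)),
      ∑ v ∈ T, (Ideal.absNorm v.asIdeal : ℝ)⁻¹ ≤ C)
    (F : Finset (Ideal (𝓞 K))) :
    ∑ I ∈ F, (Ideal.absNorm I : ℝ)⁻¹ ≤ Real.exp (2 * C) := by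
  classical
  -- discard the zero ideal
  wlog hF : ∀ I ∈ F, I ≠ 0 generalizing F
  · have := this (F.erase 0) (fun I hI => Finset.ne_of_mem_erase hI)
    refine le_trans (le_of_eq ?_) this
    symm
    apply Finset.sum_erase
    simp
  set e : Ideal (𝓞 K) → HeightOneSpectrum (𝓞 K) → ℕ := fun I v =>
    (Associates.mk v.asIdeal).count (Associates.mk I).factors with he
  set T : Finset (HeightOneSpectrum (𝓞 K)) := F.attach.biUnion fun I =>
    (Ideal.hasFiniteMulSupport (hF I.1 I.2)).toFinset with hT
  have hprod : ∀ I ∈ F, ∏ v : T, v.1.asIdeal ^ e I v.1 = I := by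
    intro I hI
    rw [Finset.prod_coe_sort T (fun v => v.asIdeal ^ e I v)]
    conv_rhs => rw [← Ideal.finprod_heightOneSpectrum_factorization (hF I hI)]
    symm
    apply finprod_eq_prod_of_mulSupport_subset
    intro v hv
    rw [Finset.mem_coe, hT, Finset.mem_biUnion]
    refine ⟨⟨I, hI⟩, Finset.mem_attach _ _, ?_⟩
    exact (Set.Finite.mem_toFinset _).2 hv
  set k : ℕ := ∑ I ∈ F, ∑ v : T, e I v.1 + 1 with hk
  have hek : ∀ I ∈ F, ∀ v : T, e I v.1 < k := by
    intro I hI v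
    have h1 : e I v.1 ≤ ∑ v : T, e I v.1 :=
      Finset.single_le_sum (f := fun v : T => e I v.1) (fun _ _ => Nat.zero_le _) (Finset.mem_univ v)
    have h2 : ∑ v : T, e I v.1 ≤ ∑ I ∈ F, ∑ v : T, e I v.1 :=
      Finset.single_le_sum (f := fun I => ∑ v : T, e I v.1) (fun _ _ => Nat.zero_le _) hI
    omega
  set x : HeightOneSpectrum (𝓞 K) → ℝ := fun v => (Ideal.absNorm v.asIdeal : ℝ)⁻¹ with hx
  have hx0 : ∀ v, 0 ≤ x v := fun v => by positivity
  have hx1 : ∀ v, x v ≤ 1 / 2 := by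
    intro v
    have h : 1 < Ideal.absNorm v.asIdeal := HeightOneSpectrum.one_lt_absNorm v
    have h' : (2 : ℝ) ≤ Ideal.absNorm v.asIdeal := by exact_mod_cast h
    rw [hx, one_div]
    exact inv_anti₀ (by norm_num) h'
  have hgeom : ∀ v, ∑ j ∈ Finset.range k, x v ^ j ≤ Real.exp (2 * x v) := by
    intro v
    have h1 := mul_neg_geom_sum (x v) k
    have h2 : 0 ≤ x v ^ k := pow_nonneg (hx0 v) k
    have h3 := Real.add_one_le_exp (2 * x v)
    have h4 : ∑ j ∈ Finset.range k, x v ^ j ≤ 2 * x v + 1 := by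
      have ha := hx0 v
      have hb := hx1 v
      have h5 : (1 - x v) * ∑ j ∈ Finset.range k, x v ^ j ≤ (1 - x v) * (2 * x v + 1) := by
        rw [h1]; nlinarith
      exact le_of_mul_le_mul_left h5 (by linarith)
    linarith
  calc ∑ I ∈ F, (Ideal.absNorm I : ℝ)⁻¹
      = ∑ I ∈ F, ∏ v : T, x v.1 ^ (e I v.1) := by
        apply Finset.sum_congr rfl
        intro I hI
        conv_lhs => rw [← hprod I hI]
        rw [map_prod, Nat.cast_prod, ← Finset.prod_inv_distrib]
        apply Finset.prod_congr rfl
        intro v _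
        simp [hx]
    _ = ∑ p ∈ F.image (fun I => fun v : T => e I v.1), ∏ v : T, x v.1 ^ p v := by
        rw [Finset.sum_image]
        intro I hI J hJ hIJ
        rw [← hprod I hI, ← hprod J hJ]
        apply Finset.prod_congr rfl
        intro v _
        rw [show e I v.1 = e J v.1 from congrFun hIJ v]
    _ ≤ ∑ p ∈ Fintype.piFinset (fun _ : T => Finset.range k), ∏ v : T, x v.1 ^ p v := by
        apply Finset.sum_le_sum_of_subset_of_nonneg
        · intro p hp
          obtain ⟨I, hI, rfl⟩ := Finset.mem_image.1 hp
          rw [Fintype.mem_piFinset]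
          intro v
          exact Finset.mem_range.2 (hek I hI v)
        · intro p _ _
          exact Finset.prod_nonneg fun v _ => pow_nonneg (hx0 _) _
    _ = ∏ v : T, ∑ j ∈ Finset.range k, x v.1 ^ j := by
        rw [Finset.prod_univ_sum]
    _ ≤ ∏ v : T, Real.exp (2 * x v.1) := by
        apply Finset.prod_le_prod
        · intro v _
          exact Finset.sum_nonneg fun j _ => pow_nonneg (hx0 _) _
        · intro v _
          exact hgeom v.1
    _ = Real.exp (2 * ∑ v ∈ T, x v) := by
        rw [← Real.exp_sum, ← Finset.mul_sum, Finset.sum_coe_sort T x]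
    _ ≤ Real.exp (2 * C) := by
        apply Real.exp_le_exp.2
        linarith [hC T]

open IsDedekindDomain in
lemma aux_not_bounded (K : Type*) [Field K] [NumberField K] (C : ℝ)
    (hC : ∀ T : Finset (HeightOneSpectrum (𝓞 K)),
      ∑ v ∈ T, (Ideal.absNorm v.asIdeal : ℝ)⁻¹ ≤ C) : False := by
  classical
  have hsum : Summable (fun I : Ideal (𝓞 K) => (Ideal.absNorm I : ℝ)⁻¹) :=
    summable_of_sum_le (fun I => by positivity) (aux_euler K C hC)
  obtain ⟨ρ, hρ, hlim⟩ := aux_count K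
  obtain ⟨F, hF⟩ := summable_iff_vanishing_norm.1 hsum (ρ / 2) (by positivity)
  have hl : Tendsto (fun n : ℕ => ((F.card : ℝ) + 1) / n + ρ / 2) atTop (𝓝 (0 + ρ / 2)) :=
    (tendsto_const_div_atTop_nhds_zero_nat _).add tendsto_const_nhds
  have : ρ ≤ 0 + ρ / 2 := by
    refine le_of_tendsto_of_tendsto hlim hl ?_
    filter_upwards [eventually_gt_atTop 0] with n hn
    have hn' : (0 : ℝ) < n := by exact_mod_cast hn
    set G := (Ideal.finite_setOfPred_absNorm_le (S := 𝓞 K) n).toFinset with hG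
    set H := G \ insert 0 F with hH
    have h1 : (G.card : ℝ) ≤ H.card + (F.card + 1) := by
      have h2 := Finset.le_card_sdiff (insert 0 F) G
      rw [← hH] at h2
      have h3 := Finset.card_insert_le 0 F
      have : G.card ≤ H.card + (F.card + 1) := by omega
      exact_mod_cast this
    have h4 : (H.card : ℝ) * (n : ℝ)⁻¹ ≤ ρ / 2 := by
      have hd : Disjoint H F := by
        rw [Finset.disjoint_left]
        intro I hI hI'
        exact (Finset.mem_sdiff.1 hI).2 (Finset.mem_insert_of_mem hI')
      have h5 := (le_abs_self _).trans (hF H hd).le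
      refine le_trans ?_ h5
      rw [← nsmul_eq_mul]
      apply Finset.card_nsmul_le_sum
      intro I hI
      rw [hH, Finset.mem_sdiff, hG, Set.Finite.mem_toFinset] at hI
      have h6 : Ideal.absNorm I ≤ n := hI.1
      have h7 : I ≠ 0 := fun h => hI.2 (h ▸ Finset.mem_insert_self _ _)
      have h8 : 0 < Ideal.absNorm I := Nat.pos_of_ne_zero (by rwa [Ne, Ideal.absNorm_eq_zero_iff])
      exact inv_anti₀ (by exact_mod_cast h8) (by exact_mod_cast h6)
    rw [div_eq_mul_inv, div_eq_mul_inv]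
    have := mul_le_mul_of_nonneg_right h1 (inv_nonneg.2 hn'.le)
    rw [add_mul] at this
    linarith
  linarith

open IsDedekindDomain in
lemma aux_fiber {K : Type*} [Field K] [NumberField K] {p : ℕ} (hp : p.Prime)
    (T : Finset (HeightOneSpectrum (𝓞 K)))
    (hT : ∀ v ∈ T, (p : 𝓞 K) ∈ v.asIdeal ∧ p ≤ Ideal.absNorm v.asIdeal) :
    T.card ≤ Module.finrank ℤ (𝓞 K) := by
  classical
  have hinj : Function.Injective (fun v : HeightOneSpectrum (𝓞 K) => v.asIdeal) :=
    fun _ _ h => HeightOneSpectrum.ext h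
  have h1 : ∏ I ∈ T.image (fun v => v.asIdeal), I ∣ Ideal.span {(p : 𝓞 K)} := by
    apply Finset.prod_primes_dvd
    · intro I hI
      obtain ⟨v, hv, rfl⟩ := Finset.mem_image.1 hI
      exact v.prime
    · intro I hI
      obtain ⟨v, hv, rfl⟩ := Finset.mem_image.1 hI
      rw [Ideal.dvd_span_singleton]
      exact (hT v hv).1
  rw [Finset.prod_image (fun _ _ _ _ h => hinj h)] at h1
  have h2 := map_dvd Ideal.absNorm h1
  rw [Ideal.absNorm_span_natCast, map_prod] at h2
  have h3 := Nat.le_of_dvd (pow_pos hp.pos _) h2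
  have h4 : p ^ T.card ≤ ∏ v ∈ T, Ideal.absNorm v.asIdeal :=
    Finset.pow_card_le_prod _ _ _ fun v hv => (hT v hv).2
  exact (Nat.pow_le_pow_iff_right hp.one_lt).1 (h4.trans h3)

open IsDedekindDomain in
lemma aux_deg_one_unbounded (K : Type*) [Field K] [NumberField K] (B : ℕ) (C : ℝ)
    (hC : ∀ S : Finset ℕ, (∀ q ∈ S, q.Prime ∧ B < q ∧ ∃ P : Ideal (𝓞 K), Ideal.absNorm P = q) →
      ∑ q ∈ S, (q : ℝ)⁻¹ ≤ C) : False := by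
  classical
  have hv : ∀ v : HeightOneSpectrum (𝓞 K), ∃ p n : ℕ, 0 < n ∧ (p : 𝓞 K) ∈ v.asIdeal ∧
      p.Prime ∧ Ideal.absNorm v.asIdeal = p ^ n := by
    intro v
    have : v.asIdeal.IsMaximal := v.isMaximal
    exact Ideal.exists_prime_and_absNorm_eq_pow v.asIdeal
  choose p n hn hpm hpp hN using hv
  have hC0 : 0 ≤ C := by simpa using hC ∅ (by simp)
  have hs : Summable (fun q : ℕ => ((q : ℝ) ^ 2)⁻¹) := Real.summable_nat_pow_inv.2 (by norm_num)
  set D := ∑' q : ℕ, ((q : ℝ) ^ 2)⁻¹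
  set g : ℕ → ℝ := fun q => (if q.Prime ∧ B < q ∧ ∃ P : Ideal (𝓞 K), Ideal.absNorm P = q then
    (q : ℝ)⁻¹ else 0) + (if q ≤ B then 1 else 0) + ((q : ℝ) ^ 2)⁻¹ with hg
  have hgle : ∀ v, (Ideal.absNorm v.asIdeal : ℝ)⁻¹ ≤ g (p v) := by
    intro v
    have hp1 : (1 : ℝ) ≤ p v := by exact_mod_cast (hpp v).one_lt.le
    have t1 : (0 : ℝ) ≤ (if (p v).Prime ∧ B < p v ∧ ∃ P : Ideal (𝓞 K), Ideal.absNorm P = p v then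
      (p v : ℝ)⁻¹ else 0) := by split_ifs <;> positivity
    have t2 : (0 : ℝ) ≤ (if p v ≤ B then 1 else 0) := by split_ifs <;> positivity
    have t3 : (0 : ℝ) ≤ ((p v : ℝ) ^ 2)⁻¹ := by positivity
    by_cases h1 : 2 ≤ n v
    · have : (Ideal.absNorm v.asIdeal : ℝ)⁻¹ ≤ ((p v : ℝ) ^ 2)⁻¹ := by
        rw [hN v]
        push_cast
        exact inv_anti₀ (by positivity) (pow_le_pow_right₀ hp1 h1)
      simp only [hg]
      linarith
    · have h2 : n v = 1 := by have := hn v; omega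
      have h3 : Ideal.absNorm v.asIdeal = p v := by rw [hN v, h2, pow_one]
      by_cases h4 : p v ≤ B
      · simp only [hg, if_pos h4]
        rw [h3]
        have : (p v : ℝ)⁻¹ ≤ 1 := inv_le_one_of_one_le₀ hp1
        linarith
      · have h5 : (p v).Prime ∧ B < p v ∧ ∃ P : Ideal (𝓞 K), Ideal.absNorm P = p v :=
          ⟨hpp v, by omega, _, h3⟩
        simp only [hg, if_pos h5]
        rw [h3]
        linarith
  have hgsum : ∀ S : Finset ℕ, ∑ q ∈ S, g q ≤ C + (B + 1) + D := by
    intro S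
    simp only [hg, Finset.sum_add_distrib]
    refine add_le_add (add_le_add ?_ ?_) ?_
    · rw [← Finset.sum_filter]
      apply hC
      intro q hq
      exact (Finset.mem_filter.1 hq).2
    · rw [← Finset.sum_filter, Finset.sum_const, nsmul_eq_mul, mul_one]
      have : (S.filter (fun q => q ≤ B)).card ≤ B + 1 := by
        rw [← Finset.card_range (B + 1)]
        apply Finset.card_le_card
        intro q hq
        have := (Finset.mem_filter.1 hq).2
        exact Finset.mem_range.2 (by omega)
      exact_mod_cast this
    · exact hs.sum_le_tsum _ fun _ _ => by positivity
  have hg0 : ∀ q, 0 ≤ g q := by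
    intro q
    simp only [hg]
    refine add_nonneg (add_nonneg ?_ ?_) ?_
    · split_ifs <;> positivity
    · split_ifs <;> positivity
    · positivity
  refine aux_not_bounded K (Module.finrank ℤ (𝓞 K) * (C + (B + 1) + D)) fun T => ?_
  calc ∑ v ∈ T, (Ideal.absNorm v.asIdeal : ℝ)⁻¹ ≤ ∑ v ∈ T, g (p v) :=
        Finset.sum_le_sum fun v _ => hgle v
    _ = ∑ q ∈ T.image p, ∑ v ∈ T with p v = q, g (p v) := by
        rw [Finset.sum_fiberwise_of_maps_to]
        intro v hv
        exact Finset.mem_image_of_mem _ hv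
    _ ≤ ∑ q ∈ T.image p, (Module.finrank ℤ (𝓞 K) : ℝ) * g q := by
        apply Finset.sum_le_sum
        intro q hq
        obtain ⟨w, hw, rfl⟩ := Finset.mem_image.1 hq
        rw [Finset.sum_congr rfl (g := fun _ => g (p w))
          (fun v hv => by rw [(Finset.mem_filter.1 hv).2])]
        rw [Finset.sum_const, nsmul_eq_mul]
        apply mul_le_mul_of_nonneg_right _ (hg0 _)
        have := aux_fiber (hpp w) (T.filter (fun v => p v = p w)) (by
          intro v hv
          have hvw := (Finset.mem_filter.1 hv).2
          rw [← hvw]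
          refine ⟨hpm v, ?_⟩
          rw [hN v]
          exact Nat.le_self_pow (hn v).ne' _)
        exact_mod_cast this
    _ = Module.finrank ℤ (𝓞 K) * ∑ q ∈ T.image p, g q := by rw [Finset.mul_sum]
    _ ≤ _ := mul_le_mul_of_nonneg_left (hgsum _) (by positivity)


lemma aux_absNorm_comap {K L : Type*} [Field K] [NumberField K] [Field L] [NumberField L]
    (σ : K →+* L) (P : Ideal (𝓞 L)) {p : ℕ} (hp : p.Prime) (hP : Ideal.absNorm P = p) :
    Ideal.absNorm (P.comap (RingOfIntegers.mapRingHom σ)) = p := by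
  set φ := RingOfIntegers.mapRingHom σ
  have h1 : P ≠ ⊤ := by
    rintro rfl
    rw [Ideal.absNorm_top] at hP
    exact hp.one_lt.ne hP
  have hinj : Function.Injective (Ideal.quotientMap P φ le_rfl) :=
    Ideal.quotientMap_injective
  have h2 : Ideal.absNorm (P.comap φ) ∣ Ideal.absNorm P :=
    AddSubgroup.card_dvd_of_injective (Ideal.quotientMap P φ le_rfl).toAddMonoidHom hinj
  rw [hP] at h2
  rcases (Nat.dvd_prime hp).1 h2 with h | h
  · rw [Ideal.absNorm_eq_one_iff, Ideal.comap_eq_top_iff] at h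
    exact absurd h h1
  · exact h

lemma aux_exists_int {K : Type*} [Field K] [NumberField K]
    (P : Ideal (𝓞 K)) {p : ℕ} (hp : p.Prime) (hP : Ideal.absNorm P = p) (θ : 𝓞 K) :
    ∃ n : ℤ, θ - n ∈ P := by
  have : Fact p.Prime := ⟨hp⟩
  have h1 : P ≠ ⊤ := by
    rintro rfl
    rw [Ideal.absNorm_top] at hP
    exact hp.one_lt.ne hP
  have : Nontrivial (𝓞 K ⧸ P) := Ideal.Quotient.nontrivial_iff.2 h1
  have hc : Nat.card (𝓞 K ⧸ P) = p := hP
  obtain ⟨n, hn⟩ := AddSubgroup.mem_zmultiples_iff.1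
    (mem_zmultiples_of_prime_card hc (g := (1 : 𝓞 K ⧸ P)) (g' := Ideal.Quotient.mk P θ) one_ne_zero)
  refine ⟨n, ?_⟩
  rw [← Ideal.Quotient.eq_zero_iff_mem, map_sub, ← hn]
  simp

lemma aux_two_primes {K L : Type*} [Field K] [NumberField K] [Field L] [NumberField L]
    (σ τ : K →+* L) (hστ : σ ≠ τ) :
    ∃ B : ℕ, ∀ p : ℕ, p.Prime → B < p → (∃ P : Ideal (𝓞 L), Ideal.absNorm P = p) →
      ∃ P Q : Ideal (𝓞 K), P ≠ Q ∧ Ideal.absNorm P = p ∧ Ideal.absNorm Q = p := by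
  obtain ⟨θ, hθ⟩ : ∃ θ : 𝓞 K, RingOfIntegers.mapRingHom σ θ ≠ RingOfIntegers.mapRingHom τ θ := by
    by_contra! h
    apply hστ
    apply IsFractionRing.ringHom_ext (A := 𝓞 K)
    intro x
    have := congrArg (fun y : 𝓞 L => (y : L)) (h x)
    simpa using this
  set δ := RingOfIntegers.mapRingHom σ θ - RingOfIntegers.mapRingHom τ θ with hδ
  have hδ0 : δ ≠ 0 := sub_ne_zero.2 hθ
  refine ⟨(Algebra.norm ℤ δ).natAbs, fun p hp hB ⟨P, hP⟩ => ⟨_, _, ?_, aux_absNorm_comap σ P hp hP,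
    aux_absNorm_comap τ P hp hP⟩⟩
  intro heq
  obtain ⟨n, hn⟩ := aux_exists_int _ hp (aux_absNorm_comap σ P hp hP) θ
  have hn' := hn
  rw [heq] at hn'
  rw [Ideal.mem_comap, map_sub, map_intCast] at hn hn'
  have hmem : δ ∈ P := by
    have := P.sub_mem hn hn'
    rwa [sub_sub_sub_cancel_right] at this
  have := Ideal.absNorm_dvd_norm_of_mem hmem
  rw [hP] at this
  have h0 : Algebra.norm ℤ δ ≠ 0 := by rwa [Ne, Algebra.norm_eq_zero_iff]
  have := Int.natAbs_dvd_natAbs.2 this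
  have := Nat.le_of_dvd (Int.natAbs_pos.2 h0) this
  simp at this
  omega

lemma aux_exponent {K : Type*} [Field K] [NumberField K] (θ : 𝓞 K)
    (hθ : Algebra.adjoin ℚ {(θ : K)} = ⊤) : RingOfIntegers.exponent θ ≠ 0 := by
  have h := conductor_mul_differentIdeal ℤ ℚ K θ hθ
  have hc : conductor ℤ θ ≠ ⊥ := by
    intro h0
    rw [h0, Ideal.bot_mul, eq_comm, Ideal.span_singleton_eq_bot] at h
    have hq : minpoly ℚ (θ : K) = (minpoly ℤ θ).map (algebraMap ℤ ℚ) := by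
      rw [← minpoly.isIntegrallyClosed_eq_field_fractions ℚ K θ.isIntegral]
    have hs : (minpoly ℚ (θ : K)).Separable := (minpoly.irreducible (Algebra.IsIntegral.isIntegral _)).separable
    have := hs.aeval_derivative_ne_zero (minpoly.aeval ℚ (θ : K))
    apply this
    rw [hq, derivative_map, aeval_map_algebraMap]
    have := congrArg (algebraMap (𝓞 K) K) h
    rw [map_zero, ← aeval_algebraMap_apply] at this
    exact this
  rw [RingOfIntegers.exponent]
  intro h0
  rw [Ideal.absNorm_eq_zero_iff] at h0
  exact hc (Ideal.eq_bot_of_comap_eq_bot h0)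

lemma aux_degree_one {K : Type*} [Field K] [NumberField K] (θ : 𝓞 K) {p : ℕ} (hp : p.Prime)
    (hpe : ¬ p ∣ RingOfIntegers.exponent θ) (y : ℤ) (hy : (p : ℤ) ∣ (minpoly ℤ θ).eval y) :
    ∃ P : Ideal (𝓞 K), Ideal.absNorm P = p := by
  have : Fact p.Prime := ⟨hp⟩
  have hmap : (X - C y : ℤ[X]).map (Int.castRingHom (ZMod p)) = X - C (y : ZMod p) := by simp
  have h₀ : map (Int.castRingHom (ZMod p)) (minpoly ℤ θ) ≠ 0 :=
      map_monic_ne_zero (minpoly.monic θ.isIntegral)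
  have hQ : (X - C y : ℤ[X]).map (Int.castRingHom (ZMod p)) ∈ RingOfIntegers.monicFactorsMod θ p := by
    rw [Multiset.mem_toFinset, Polynomial.mem_normalizedFactors_iff h₀, hmap]
    refine ⟨irreducible_X_sub_C _, monic_X_sub_C _, ?_⟩
    rw [dvd_iff_isRoot, IsRoot, eval_intCast_map]
    simpa using (ZMod.intCast_zmod_eq_zero_iff_dvd _ _).2 hy
  refine ⟨_, (Nat.card_congr (RingOfIntegers.ZModXQuotSpanEquivQuotSpanPair hpe hQ).toEquiv).symm.trans ?_⟩
  rw [hmap]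
  rw [Nat.card_congr (Polynomial.quotientSpanXSubCAlgEquiv (y : ZMod p)).toEquiv, Nat.card_zmod]

lemma aux_root_degree_one (f : ℤ[X]) (hf0 : f ≠ 0) (hd : 0 < f.natDegree)
    {K : Type*} [Field K] [NumberField K] (α : K) (hroot : aeval α f = 0)
    (hadj : Algebra.adjoin ℚ {α} = ⊤) (hfin : Module.finrank ℚ K = f.natDegree) :
    ∃ B : ℕ, ∀ p : ℕ, p.Prime → B < p → (∃ x : ℤ, (p : ℤ) ∣ f.eval x) →
      ∃ P : Ideal (𝓞 K), Ideal.absNorm P = p := by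
  have ha : f.leadingCoeff ≠ 0 := leadingCoeff_ne_zero.2 hf0
  set a := f.leadingCoeff with ha'
  set g := f.integralNormalization
  have hg : g.Monic := monic_integralNormalization hf0
  have hgroot : eval₂ (algebraMap ℤ K) (algebraMap ℤ K a * α) g = 0 := by
    rw [integralNormalization_eval₂_leadingCoeff_mul hd, ← aeval_def, hroot, mul_zero]
  set θ : 𝓞 K := ⟨algebraMap ℤ K a * α, ⟨g, hg, hgroot⟩⟩
  have hθ : Algebra.adjoin ℚ {(θ : K)} = ⊤ := by
    rw [eq_top_iff, ← hadj, Algebra.adjoin_le_iff, Set.singleton_subset_iff]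
    have h1 : (θ : K) ∈ Algebra.adjoin ℚ {(θ : K)} := Algebra.self_mem_adjoin_singleton _ _
    have h2 := Subalgebra.smul_mem _ h1 ((a : ℚ)⁻¹)
    convert! h2
    have : (a : ℚ) ≠ 0 := by exact_mod_cast ha
    change α = (a : ℚ)⁻¹ • (algebraMap ℤ K a * α)
    rw [Algebra.smul_def, ← mul_assoc, IsScalarTower.algebraMap_apply ℤ ℚ K, ← map_mul]
    simp [this]
  have hmin : minpoly ℤ θ = g := by
    have hdvd : minpoly ℤ θ ∣ g := by
      apply minpoly.isIntegrallyClosed_dvd θ.isIntegral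
      apply RingOfIntegers.ext
      have := aeval_algebraMap_apply K θ g
      exact this.symm.trans hgroot
    symm
    refine (eq_of_monic_of_dvd_of_natDegree_le (minpoly.monic θ.isIntegral) hg hdvd ?_)
    have hq : minpoly ℚ (θ : K) = (minpoly ℤ θ).map (algebraMap ℤ ℚ) := by
      rw [← minpoly.isIntegrallyClosed_eq_field_fractions ℚ K θ.isIntegral]
    have h1 : (minpoly ℤ θ).natDegree = (minpoly ℚ (θ : K)).natDegree := by
      rw [hq, natDegree_map_eq_of_injective (algebraMap ℤ ℚ).injective_int]
    have hint : IsIntegral ℚ (θ : K) := Algebra.IsIntegral.isIntegral _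
    have h2 : (minpoly ℚ (θ : K)).natDegree = Module.finrank ℚ K := by
      have e : IntermediateField.adjoin ℚ {(θ : K)} = ⊤ := by
        rw [eq_top_iff]
        intro z _
        have : z ∈ Algebra.adjoin ℚ {(θ : K)} := by rw [hθ]; trivial
        exact IntermediateField.algebra_adjoin_le_adjoin _ _ this
      rw [← IntermediateField.adjoin.finrank hint, e, IntermediateField.finrank_top']
    rw [h1, h2, hfin, natDegree_integralNormalization]
  have he := aux_exponent θ hθ
  refine ⟨RingOfIntegers.exponent θ, fun p hp hB ⟨x, hx⟩ => ?_⟩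
  refine aux_degree_one θ hp (fun h => ?_) (a * x) ?_
  · have := Nat.le_of_dvd (Nat.pos_of_ne_zero he) h
    omega
  · rw [hmin]
    have := integralNormalization_eval₂_leadingCoeff_mul hd (RingHom.id ℤ) x
    simp only [eval₂_id, RingHom.id_apply] at this
    rw [ha', this]
    exact Dvd.dvd.mul_left hx _

lemma aux_exists_prime_abstract (f : ℤ[X]) (hf0 : f ≠ 0) (hd : 0 < f.natDegree)
    {K L : Type*} [Field K] [NumberField K] [Field L] [NumberField L]
    (α : K) (hroot : aeval α f = 0) (hadj : Algebra.adjoin ℚ {α} = ⊤)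
    (hfin : Module.finrank ℚ K = f.natDegree) (σ τ : K →+* L) (hστ : σ ≠ τ) :
    ∃ p : ℕ, p.Prime ∧ ∀ x : ℤ, ¬ (p : ℤ) ∣ f.eval x := by
  by_contra! hcon
  obtain ⟨B₁, h₁⟩ := aux_root_degree_one f hf0 hd α hroot hadj hfin
  obtain ⟨B₂, h₂⟩ := aux_two_primes σ τ hστ
  obtain ⟨C, hC⟩ := aux_two_bound (K := K) (max B₁ B₂) fun p hp hB =>
    h₁ p hp (lt_of_le_of_lt (le_max_left _ _) hB) (hcon p hp)
  refine aux_deg_one_unbounded L (max B₁ B₂) C fun S hS => hC S fun q hq => ?_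
  obtain ⟨hq1, hq2, hq3⟩ := hS q hq
  exact ⟨hq1, hq2, h₂ q hq1 (lt_of_le_of_lt (le_max_right _ _) hq2) hq3⟩

lemma aux_exists_prime_alg (f : ℤ[X]) (hf0 : f ≠ 0) (hd : 0 < f.natDegree)
    {K L : Type*} [Field K] [NumberField K] [Field L] [NumberField L] [inst : Algebra ℚ K]
    (α : K) (hroot : aeval α (f.map (algebraMap ℤ ℚ)) = 0) (hadj : Algebra.adjoin ℚ {α} = ⊤)
    (hfin : Module.finrank ℚ K = f.natDegree) (σ τ : K →+* L) (hστ : σ ≠ τ) :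
    ∃ p : ℕ, p.Prime ∧ ∀ x : ℤ, ¬ (p : ℤ) ∣ f.eval x := by
  obtain rfl : inst = DivisionRing.toRatAlgebra := Subsingleton.elim _ _
  rw [aeval_map_algebraMap] at hroot
  exact aux_exists_prime_abstract f hf0 hd α hroot hadj hfin σ τ hστ

lemma aux_exists_prime (f : ℤ[X]) (hirr : Irreducible f) (hd : 2 ≤ f.natDegree) :
    ∃ p : ℕ, p.Prime ∧ ∀ x : ℤ, ¬ (p : ℤ) ∣ f.eval x := by
  have hf0 : f ≠ 0 := hirr.ne_zero
  have hprim : f.IsPrimitive := hirr.isPrimitive (by omega)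
  have hinj : Function.Injective (algebraMap ℤ ℚ) := (algebraMap ℤ ℚ).injective_int
  have hQ : Irreducible (f.map (algebraMap ℤ ℚ)) :=
    (IsPrimitive.Int.irreducible_iff_irreducible_map_cast hprim).1 hirr
  have hQd : (f.map (algebraMap ℤ ℚ)).natDegree = f.natDegree :=
    natDegree_map_eq_of_injective hinj f
  have : Fact (Irreducible (f.map (algebraMap ℤ ℚ))) := ⟨hQ⟩
  let E := (f.map (algebraMap ℤ ℚ)).SplittingField
  have hsplit : ((f.map (algebraMap ℤ ℚ)).map (algebraMap ℚ E)).Splits :=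
    SplittingField.splits _
  have hcard := card_rootSet_eq_natDegree (K := E) hQ.separable hsplit
  rw [hQd] at hcard
  obtain ⟨β, γ, hβγ⟩ := Fintype.one_lt_card_iff.1 (by rw [hcard]; omega)
  have : CharZero E := charZero_of_injective_algebraMap (algebraMap ℚ E).injective
  have : NumberField E := { to_charZero := inferInstance, to_finiteDimensional := by
                                convert (inferInstance : FiniteDimensional ℚ E) }
  have : FiniteDimensional ℚ (AdjoinRoot (f.map (algebraMap ℤ ℚ))) :=
    (AdjoinRoot.powerBasis hQ.ne_zero).finite
  have : CharZero (AdjoinRoot (f.map (algebraMap ℤ ℚ))) :=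
    charZero_of_injective_algebraMap (algebraMap ℚ (AdjoinRoot (f.map (algebraMap ℤ ℚ)))).injective
  have : NumberField (AdjoinRoot (f.map (algebraMap ℤ ℚ))) :=
    { to_charZero := inferInstance, to_finiteDimensional := by
        convert (inferInstance : FiniteDimensional ℚ (AdjoinRoot (f.map (algebraMap ℤ ℚ)))) }
  have hβ : (f.map (algebraMap ℤ ℚ)).eval₂ (algebraMap ℚ E) β = 0 := aeval_eq_zero_of_mem_rootSet β.2
  have hγ : (f.map (algebraMap ℤ ℚ)).eval₂ (algebraMap ℚ E) γ = 0 := aeval_eq_zero_of_mem_rootSet γ.2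
  refine aux_exists_prime_alg f hf0 (by omega)
    (K := AdjoinRoot (f.map (algebraMap ℤ ℚ))) (L := E)
    (AdjoinRoot.root _) ?_ ?_ ?_ (AdjoinRoot.lift (algebraMap ℚ E) β hβ)
    (AdjoinRoot.lift (algebraMap ℚ E) γ hγ) ?_
  · exact AdjoinRoot.eval₂_root (f.map (algebraMap ℤ ℚ))
  · exact AdjoinRoot.adjoinRoot_eq_top
  · rw [← hQd]
    exact (AdjoinRoot.powerBasis hQ.ne_zero).finrank.trans (AdjoinRoot.powerBasis_dim _)
  · intro h
    apply hβγ
    have := congrArg (fun g => g (AdjoinRoot.root _)) h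
    simp only [AdjoinRoot.lift_root] at this
    exact Subtype.ext this

end Helpers

/-- Let `f(x) ∈ ℤ[x]` be an irreducible polynomial of degree `d`, `b` a fixed
non-zero integer and `A 0, ..., A (r-1)` fixed positive integers, with `d > r`. Then
`f(x) = b * (n₁! A₁^{n₁}) ⋯ (n_r! A_r^{n_r})` has only finitely many solutions in positive
integers `n₁, ..., n_r` and integers `x`. -/
theorem stmt_6 (d : ℕ) (f : Polynomial ℤ) (hirr : Irreducible f) (hdeg : f.natDegree = d)
    (r : ℕ) (b : ℤ) (hb : b ≠ 0) (A : Fin r → ℕ) (hA : ∀ i, 0 < A i) (hd : r < d) :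
    {p : (Fin r → ℕ) × ℤ | (∀ i, 0 < p.1 i) ∧
      f.eval p.2 = b * ∏ i, (((p.1 i).factorial : ℤ) * (A i : ℤ) ^ (p.1 i))}.Finite := by
  have hfib : ∀ c : ℤ, {x : ℤ | f.eval x = c}.Finite := by
    intro c
    have h0 : f - Polynomial.C c ≠ 0 := by
      intro h
      have : f = Polynomial.C c := sub_eq_zero.1 h
      rw [this, Polynomial.natDegree_C] at hdeg
      omega
    refine (f - Polynomial.C c).roots.toFinset.finite_toSet.subset fun x hx => ?_
    have hx : f.eval x = c := hx
    rw [Finset.mem_coe, Multiset.mem_toFinset, Polynomial.mem_roots h0, Polynomial.IsRoot.def,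
      Polynomial.eval_sub, Polynomial.eval_C, hx, sub_self]
  have hbound : ∃ N : ℕ, ∀ (n : Fin r → ℕ) (x : ℤ),
      f.eval x = b * ∏ i, (((n i).factorial : ℤ) * (A i : ℤ) ^ (n i)) → ∀ i, n i < N := by
    rcases Nat.eq_zero_or_pos r with h | h
    · subst h
      exact ⟨0, fun n x _ i => i.elim0⟩
    · obtain ⟨p, hp, hroot⟩ := aux_exists_prime f hirr (by omega)
      refine ⟨p, fun n x hx i => ?_⟩
      by_contra! hi
      apply hroot x
      rw [hx]
      have h1 : (p : ℤ) ∣ ((n i).factorial : ℤ) := by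
        exact_mod_cast (hp.dvd_factorial.2 hi)
      exact dvd_mul_of_dvd_right ((dvd_mul_of_dvd_left h1 _).trans
        (Finset.dvd_prod_of_mem (fun i => (((n i).factorial : ℤ) * (A i : ℤ) ^ (n i)))
          (Finset.mem_univ i))) _
  obtain ⟨N, hN⟩ := hbound
  have hfin : (Set.pi Set.univ (fun _ : Fin r => Set.Iio N)).Finite :=
    Set.Finite.pi fun _ => Set.finite_Iio N
  refine (hfin.biUnion fun n _ => (hfib (b * ∏ i, (((n i).factorial : ℤ) *
    (A i : ℤ) ^ (n i)))).image fun x => (n, x)).subset ?_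
  rintro ⟨n, x⟩ ⟨-, hx⟩
  refine Set.mem_biUnion (x := n) (fun i _ => hN n x hx i) ⟨x, hx, rfl⟩
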